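/- arXiv:math/0603501 — 2 statements merged into one kernel-verified Lean document; each statement's English description precedes it below -/
import Mathlib

section
/- Let M be a Hilbert C*-module over a C*-algebra A. Let φ : M⁵ → [0, ∞) be a control function such that lim_{n→∞} φ(2ⁿx, 2ⁿy, 2ⁿu, 2ⁿv, 2ⁿw)/2ⁿ = 0 for all x, y, u, v, w ∈ M. Suppose f : M → M satisfies f(0) = 0 and ‖f(μx + y) − μf(x) − f(y) + f(⟨u, v⟩w) − ⟨f(u), v⟩w − ⟨u, f(v)⟩w − ⟨u, v⟩f(w)‖ ≤ φ(x, y, u, v, w) for all μ ∈ 𝕋 = {z ∈ ℂ : |z| = 1} and all x, y, u, v, w ∈ M. Assume there exists 0 ≤ L₀ < 1 such that the mapping ψ(x) = φ(x/2, x/2, 0, 0, 0) satisfies ψ(x) ≤ 2·L₀·ψ(x/2) for all x ∈ M. Then there exists a unique derivation T₀ : M → M such that ‖f(x) − T₀(x)‖ ≤ (L₀/(1 − L₀))·ψ(x) for all x ∈ M; moreover T₀(x) = lim_{n→∞} f(2ⁿx)/2ⁿ. -/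
open Filter

/-- A ℂ-linear mapping `T : M → M` is a *derivation* on a Hilbert `A`-module `M`
(with `A`-valued inner product `ip`) if
`T (⟨x, y⟩ • z) = ⟨T x, y⟩ • z + ⟨x, T y⟩ • z + ⟨x, y⟩ • T z` for all `x, y, z`. -/
def IsHilbertModuleDerivation {A M : Type*} [Ring A] [AddCommGroup M]
    [Module ℂ M] [Module A M] (ip : M → M → A) (T : M → M) : Prop :=
  IsLinearMap ℂ T ∧
    ∀ x y z : M, T (ip x y • z) = ip (T x) y • z + ip x (T y) • z + ip x y • T z

/-- A function that is additive up to unimodular scalars is `ℂ`-linear. -/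
theorem isLinearMap_of_map_unimodular_smul_add {E F : Type*} [AddCommGroup E] [Module ℂ E]
    [AddCommGroup F] [Module ℂ F] {T : E → F}
    (hT : ∀ μ : ℂ, ‖μ‖ = 1 → ∀ x y, T (μ • x + y) = μ • T x + T y) : IsLinearMap ℂ T := by
  have hadd : ∀ x y, T (x + y) = T x + T y := fun x y => by simpa using hT 1 (by simp) x y
  let S : E →+ F := AddMonoidHom.mk' T hadd
  have hunit : ∀ μ : ℂ, ‖μ‖ = 1 → ∀ x, T (μ • x) = μ • T x := fun μ hμ x => by
    simpa [show T 0 = 0 from S.map_zero] using hT μ hμ x 0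
  refine ⟨hadd, fun c x => ?_⟩
  obtain ⟨n, hn⟩ := exists_nat_gt ‖c‖
  have hn0 : (0 : ℝ) < n := (norm_nonneg c).trans_lt hn
  set α := Real.arccos (‖c‖ / (2 * n))
  have hcos : Complex.cos α = ‖c‖ / (2 * n) := by
    have h : Real.cos α = ‖c‖ / (2 * n) := by
      have hpos : 0 ≤ ‖c‖ / (2 * n) := by positivity
      refine Real.cos_arccos (by linarith) ?_
      rw [div_le_one (by positivity)]
      linarith
    exact_mod_cast congrArg (fun t : ℝ => (t : ℂ)) h
  set u := Complex.exp ((c.arg + α : ℝ) * Complex.I)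
  set v := Complex.exp ((c.arg - α : ℝ) * Complex.I)
  have hu : ‖u‖ = 1 := Complex.norm_exp_ofReal_mul_I _
  have hv : ‖v‖ = 1 := Complex.norm_exp_ofReal_mul_I _
  have hc : c = n * (u + v) := by
    have huv : u + v = 2 * Complex.cos α * Complex.exp (c.arg * Complex.I) := by
      simp only [u, v, Complex.two_cos, sub_eq_add_neg, Complex.ofReal_add,
        Complex.ofReal_neg, add_mul, Complex.exp_add]
      ring
    have hn' : (n : ℂ) ≠ 0 := by exact_mod_cast hn0.ne'
    conv_lhs => rw [← Complex.norm_mul_exp_arg_mul_I c]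
    rw [huv, hcos]
    field_simp
  have key : T ((n : ℂ) • (u + v) • x) = (n : ℂ) • (u + v) • T x := by
    rw [Nat.cast_smul_eq_nsmul, Nat.cast_smul_eq_nsmul, add_smul, add_smul, ← hunit u hu,
      ← hunit v hv, ← hadd]
    exact S.map_nsmul n _
  rw [hc, mul_smul, mul_smul, key]

/-- The `n`-th iterate of `ψ (2 x) ≤ 2 L ψ x`, normalised. -/
theorem inv_two_pow_mul_le_of_two_smul_le {E : Type*} [AddCommGroup E] [Module ℂ E] {ψ : E → ℝ}
    {L : ℝ} (hL : 0 ≤ L) (hψ : ∀ x, ψ ((2 : ℂ) • x) ≤ 2 * L * ψ x) (n : ℕ) (x : E) :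
    ((2 : ℝ) ^ n)⁻¹ * ψ ((2 : ℂ) ^ n • x) ≤ ψ x * L ^ n := by
  rw [inv_mul_le_iff₀ (by positivity)]
  induction n with
  | zero => simp
  | succ n ih =>
    rw [pow_succ', mul_smul]
    calc _ ≤ 2 * L * ψ ((2 : ℂ) ^ n • x) := hψ _
      _ ≤ 2 * L * (2 ^ n * (ψ x * L ^ n)) := by gcongr
      _ = _ := by ring

/-- The direct method: if `f (2 x)` is close to `2 f x`, then `f (2ⁿ x) / 2ⁿ` converges. -/
theorem exists_tendsto_inv_two_pow_smul {E F : Type*} [AddCommGroup E] [Module ℂ E]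
    [NormedAddCommGroup F] [NormedSpace ℂ F] [CompleteSpace F] {f : E → F} {ψ : E → ℝ}
    {L : ℝ} (hL : 0 ≤ L) (hL1 : L < 1) (hψ : ∀ x, ψ ((2 : ℂ) • x) ≤ 2 * L * ψ x)
    (hf : ∀ x, ‖f ((2 : ℂ) • x) - (2 : ℂ) • f x‖ ≤ ψ ((2 : ℂ) • x)) (x : E) :
    ∃ t, Tendsto (fun n : ℕ => ((2 : ℂ) ^ n)⁻¹ • f ((2 : ℂ) ^ n • x)) atTop (nhds t) ∧
      ‖f x - t‖ ≤ L / (1 - L) * ψ x := by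
  set a : ℕ → F := fun n => ((2 : ℂ) ^ n)⁻¹ • f ((2 : ℂ) ^ n • x)
  have hstep : ∀ n, dist (a n) (a (n + 1)) ≤ L * ψ x * L ^ n := fun n => by
    have h : a (n + 1) - a n = ((2 : ℂ) ^ (n + 1))⁻¹ •
        (f ((2 : ℂ) • (2 : ℂ) ^ n • x) - (2 : ℂ) • f ((2 : ℂ) ^ n • x)) := by
      simp only [a, smul_sub, smul_smul, ← pow_succ']
      congr 2
      field_simp
      ring
    rw [dist_comm, dist_eq_norm, h, norm_smul, norm_inv, norm_pow, Complex.norm_ofNat]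
    calc _ ≤ ((2 : ℝ) ^ (n + 1))⁻¹ * (2 * L * ψ ((2 : ℂ) ^ n • x)) := by
          gcongr
          exact (hf _).trans (hψ _)
      _ = L * (((2 : ℝ) ^ n)⁻¹ * ψ ((2 : ℂ) ^ n • x)) := by rw [pow_succ]; field_simp
      _ ≤ L * (ψ x * L ^ n) :=
          mul_le_mul_of_nonneg_left (inv_two_pow_mul_le_of_two_smul_le hL hψ n x) hL
      _ = _ := by ring
  obtain ⟨t, ht⟩ := cauchySeq_tendsto_of_complete (cauchySeq_of_le_geometric L _ hL1 hstep)
  refine ⟨t, ht, ?_⟩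
  have h := dist_le_of_le_geometric_of_tendsto₀ L _ hL1 hstep ht
  rw [dist_eq_norm] at h
  simpa [a, div_mul_eq_mul_div] using h

/-- A `ℂ`-homogeneous map close to `f` is the pointwise limit of `f (2ⁿ x) / 2ⁿ`. -/
theorem tendsto_inv_two_pow_smul_of_norm_sub_le {E F : Type*} [AddCommGroup E] [Module ℂ E]
    [NormedAddCommGroup F] [NormedSpace ℂ F] {f T : E → F} {ψ : E → ℝ}
    {L C : ℝ} (hL : 0 ≤ L) (hL1 : L < 1) (hC : 0 ≤ C)
    (hψ : ∀ x, ψ ((2 : ℂ) • x) ≤ 2 * L * ψ x) (hT : ∀ (c : ℂ) x, T (c • x) = c • T x)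
    (hf : ∀ x, ‖f x - T x‖ ≤ C * ψ x) (x : E) :
    Tendsto (fun n : ℕ => ((2 : ℂ) ^ n)⁻¹ • f ((2 : ℂ) ^ n • x)) atTop (nhds (T x)) := by
  rw [tendsto_iff_norm_sub_tendsto_zero]
  have hlim : Tendsto (fun n : ℕ => C * (ψ x * L ^ n)) atTop (nhds 0) := by
    simpa using ((tendsto_pow_atTop_nhds_zero_of_lt_one hL hL1).const_mul (ψ x)).const_mul C
  refine squeeze_zero (fun _ => norm_nonneg _) (fun n => ?_) hlim
  have h : ((2 : ℂ) ^ n)⁻¹ • f ((2 : ℂ) ^ n • x) - T x =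
      ((2 : ℂ) ^ n)⁻¹ • (f ((2 : ℂ) ^ n • x) - T ((2 : ℂ) ^ n • x)) := by
    rw [hT, smul_sub, inv_smul_smul₀ (pow_ne_zero n two_ne_zero)]
  rw [h, norm_smul, norm_inv, norm_pow, Complex.norm_ofNat]
  calc _ ≤ ((2 : ℝ) ^ n)⁻¹ * (C * ψ ((2 : ℂ) ^ n • x)) := by gcongr; exact hf _
    _ = C * (((2 : ℝ) ^ n)⁻¹ * ψ ((2 : ℂ) ^ n • x)) := by ring
    _ ≤ _ := mul_le_mul_of_nonneg_left (inv_two_pow_mul_le_of_two_smul_le hL hψ n x) hC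

/-- The action of a C⋆-algebra on a Hilbert C⋆-module is contractive. -/
theorem CStarModule.norm_op_smul_le {A E : Type*} [NonUnitalCStarAlgebra A] [PartialOrder A]
    [AddCommGroup E] [Module ℂ E] [SMul A E] [Norm E] [CStarModule A E] (a : A) (x : E) :
    ‖a • x‖ ≤ ‖a‖ * ‖x‖ := by
  refine le_of_sq_le_sq ?_ (mul_nonneg (norm_nonneg a) (CStarModule.norm_nonneg A))
  rw [mul_pow, norm_sq_eq A (x := a • x), norm_sq_eq A (x := x), inner_op_smul_right, inner_op_smul_left]
  calc _ ≤ ‖a‖ * (‖inner A x x‖ * ‖star a‖) :=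
        (norm_mul_le _ _).trans (by gcongr; exact norm_mul_le _ _)
    _ = _ := by rw [norm_star]; ring

/-- **Hyers–Ulam–Rassias stability of derivations on Hilbert C*-modules (Theorem 2.3).**
Let `M` be a Hilbert C*-module over a C*-algebra `A` and `φ : M⁵ → [0, ∞)` a control
function with `lim_n φ(2ⁿx, 2ⁿy, 2ⁿu, 2ⁿv, 2ⁿw) / 2ⁿ = 0`.  Suppose `f : M → M`
satisfies `f 0 = 0` and
`‖f (μx + y) − μ f x − f y + f (⟨u,v⟩w) − ⟨f u, v⟩w − ⟨u, f v⟩w − ⟨u,v⟩ f w‖ ≤ φ(x,y,u,v,w)`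
for all `μ ∈ 𝕋` and all `x, y, u, v, w ∈ M`.  If there is `0 ≤ L₀ < 1` such that
`ψ x = φ(x/2, x/2, 0, 0, 0)` satisfies `ψ x ≤ 2 L₀ ψ (x/2)`, then there exists a unique
derivation `T₀ : M → M` with `‖f x − T₀ x‖ ≤ (L₀ / (1 − L₀)) ψ x` for all `x`; moreover
`T₀ x = lim_n f (2ⁿ x) / 2ⁿ`. -/
theorem stability_of_derivations_on_HilbertCStarModules
    {A : Type*} [NormedRing A] [StarRing A] [CStarRing A] [NormedAlgebra ℂ A]
    [StarModule ℂ A] [CompleteSpace A] [PartialOrder A] [StarOrderedRing A]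
    {M : Type*} [NormedAddCommGroup M] [NormedSpace ℂ M] [CompleteSpace M]
    [Module A M] [IsScalarTower ℂ A M]
    -- the `A`-valued inner product making `M` a Hilbert `A`-module
    (ip : M → M → A)
    (ip_pos : ∀ x : M, 0 ≤ ip x x)
    (ip_def : ∀ x : M, ip x x = 0 ↔ x = 0)
    (ip_add_smul : ∀ (l : ℂ) (x y z : M), ip (l • x + y) z = l • ip x z + ip y z)
    (ip_smul : ∀ (a : A) (x y : M), ip (a • x) y = a * ip x y)
    (ip_star : ∀ x y : M, star (ip x y) = ip y x)
    (ip_norm : ∀ x : M, ‖x‖ = Real.sqrt ‖ip x x‖)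
    -- the control function
    (φ : M → M → M → M → M → ℝ)
    (φ_nonneg : ∀ x y u v w : M, 0 ≤ φ x y u v w)
    (φ_lim : ∀ x y u v w : M,
      Tendsto (fun n : ℕ =>
          φ ((2 : ℂ) ^ n • x) ((2 : ℂ) ^ n • y) ((2 : ℂ) ^ n • u)
            ((2 : ℂ) ^ n • v) ((2 : ℂ) ^ n • w) / (2 : ℝ) ^ n)
        atTop (nhds 0))
    -- the approximate derivation
    (f : M → M) (hf0 : f 0 = 0)
    (hf : ∀ μ : ℂ, ‖μ‖ = 1 → ∀ x y u v w : M,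
      ‖f (μ • x + y) - μ • f x - f y + f (ip u v • w)
          - ip (f u) v • w - ip u (f v) • w - ip u v • f w‖ ≤ φ x y u v w)
    (L₀ : ℝ) (hL₀ : 0 ≤ L₀) (hL₀1 : L₀ < 1)
    (hψ : ∀ x : M,
      φ ((2 : ℂ)⁻¹ • x) ((2 : ℂ)⁻¹ • x) 0 0 0 ≤
        2 * L₀ * φ ((2 : ℂ)⁻¹ • ((2 : ℂ)⁻¹ • x)) ((2 : ℂ)⁻¹ • ((2 : ℂ)⁻¹ • x)) 0 0 0) :
    ∃ T₀ : M → M,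
      (IsHilbertModuleDerivation ip T₀ ∧
        (∀ x : M, ‖f x - T₀ x‖ ≤
          L₀ / (1 - L₀) * φ ((2 : ℂ)⁻¹ • x) ((2 : ℂ)⁻¹ • x) 0 0 0) ∧
        (∀ x : M, Tendsto (fun n : ℕ => ((2 : ℂ) ^ n)⁻¹ • f ((2 : ℂ) ^ n • x))
          atTop (nhds (T₀ x)))) ∧
      (∀ T : M → M, IsHilbertModuleDerivation ip T →
        (∀ x : M, ‖f x - T x‖ ≤
          L₀ / (1 - L₀) * φ ((2 : ℂ)⁻¹ • x) ((2 : ℂ)⁻¹ • x) 0 0 0) →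
        T = T₀) := by
  let _ : CStarAlgebra A := { }
  let _ : CStarModule A M :=
    { inner := fun x y => ip y x
      inner_add_right := fun {x y z} => by simpa using ip_add_smul 1 y z x
      inner_self_nonneg := ip_pos _
      inner_self := ip_def _
      inner_op_smul_right := ip_smul _ _ _
      inner_smul_right_complex := fun {c x y} => by
        have h0 : ip 0 x = 0 := by simpa using ip_add_smul 1 0 0 x
        simpa [h0] using ip_add_smul c y 0 x
      star_inner := fun x y => ip_star y x
      norm_eq_sqrt_norm_inner_self := ip_norm }
  have hip : ∀ x y, ip x y = inner A y x := fun _ _ => rfl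
  have ip_cont : Continuous fun p : M × M => ip p.1 p.2 :=
    (CStarModule.continuous_inner (A := A) (E := M)).comp continuous_swap
  have : IsBoundedSMul A M := IsBoundedSMul.of_norm_smul_le CStarModule.norm_op_smul_le
  set ψ : M → ℝ := fun x => φ ((2 : ℂ)⁻¹ • x) ((2 : ℂ)⁻¹ • x) 0 0 0 with hψ_def
  have hψ2 : ∀ x, ψ ((2 : ℂ) • x) ≤ 2 * L₀ * ψ x := fun x => by
    simpa only [hψ_def, inv_smul_smul₀ (two_ne_zero' ℂ)] using hψ ((2 : ℂ) • x)
  have hlin : ∀ μ : ℂ, ‖μ‖ = 1 → ∀ x y, ‖f (μ • x + y) - μ • f x - f y‖ ≤ φ x y 0 0 0 :=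
    fun μ hμ x y => by simpa [hip, hf0] using hf μ hμ x y 0 0 0
  have hder : ∀ u v w, ‖f (ip u v • w) - ip (f u) v • w - ip u (f v) • w - ip u v • f w‖ ≤
      φ 0 0 u v w := fun u v w => by simpa [hf0] using hf 1 (by simp) 0 0 u v w
  have hf2 : ∀ x, ‖f ((2 : ℂ) • x) - (2 : ℂ) • f x‖ ≤ ψ ((2 : ℂ) • x) := fun x => by
    simp only [hψ_def, inv_smul_smul₀ (two_ne_zero' ℂ)]
    simpa only [two_smul, one_smul, sub_sub] using hlin 1 norm_one x x
  choose T hT hTf using exists_tendsto_inv_two_pow_smul hL₀ hL₀1 hψ2 hf2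
  have hTlin : IsLinearMap ℂ T := by
    refine isLinearMap_of_map_unimodular_smul_add fun μ hμ x y => ?_
    have h1 := ((hT (μ • x + y)).sub ((hT x).const_smul μ)).sub (hT y)
    have h2 := φ_lim x y 0 0 0
    simp only [smul_zero] at h2
    have h3 : T (μ • x + y) - μ • T x - T y = 0 := by
      refine tendsto_nhds_unique h1 (squeeze_zero_norm (fun n => ?_) h2)
      have h := hlin μ hμ ((2 : ℂ) ^ n • x) ((2 : ℂ) ^ n • y)
      rw [smul_comm μ, ← smul_add] at h
      rw [smul_comm μ, ← smul_sub, ← smul_sub, norm_smul, norm_inv, norm_pow,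
        Complex.norm_ofNat, inv_mul_eq_div]
      gcongr
    rwa [sub_sub, sub_eq_zero] at h3
  refine ⟨T, ⟨⟨hTlin, fun x y z => ?_⟩, hTf, hT⟩, fun S hS hSf => funext fun x => ?_⟩
  · have hxy : Tendsto (fun n : ℕ => ((2 : ℂ) ^ (3 * n))⁻¹ • f ((2 : ℂ) ^ (3 * n) • ip x y • z))
        atTop (nhds (T (ip x y • z))) :=
      (hT (ip x y • z)).comp (tendsto_id.const_mul_atTop' (by norm_num))
    have hl := (ip_cont.tendsto (T x, y)).comp ((hT x).prodMk_nhds tendsto_const_nhds)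
    have hr := (ip_cont.tendsto (x, T y)).comp (tendsto_const_nhds.prodMk_nhds (hT y))
    have h1 := ((hxy.sub (hl.smul_const z)).sub (hr.smul_const z)).sub
      ((hT z).const_smul (ip x y))
    have h2 := φ_lim 0 0 x y z
    simp only [smul_zero] at h2
    have h3 : T (ip x y • z) - ip (T x) y • z - ip x (T y) • z - ip x y • T z = 0 := by
      refine tendsto_nhds_unique h1 (squeeze_zero_norm (fun n => ?_) h2)
      have h := hder ((2 : ℂ) ^ n • x) ((2 : ℂ) ^ n • y) ((2 : ℂ) ^ n • z)
      have hc : ((2 : ℂ) ^ n) ≠ 0 := pow_ne_zero n two_ne_zero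
      have hs : star ((2 : ℂ) ^ n) = (2 : ℂ) ^ n := by simp
      have hp : (2 : ℂ) ^ (3 * n) = (2 : ℂ) ^ n * (2 : ℂ) ^ n * (2 : ℂ) ^ n := by ring
      have key : ((2 : ℂ) ^ (3 * n))⁻¹ • f ((2 : ℂ) ^ (3 * n) • ip x y • z) -
          ip (((2 : ℂ) ^ n)⁻¹ • f ((2 : ℂ) ^ n • x)) y • z -
          ip x (((2 : ℂ) ^ n)⁻¹ • f ((2 : ℂ) ^ n • y)) • z -
          ip x y • ((2 : ℂ) ^ n)⁻¹ • f ((2 : ℂ) ^ n • z) =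
          ((2 : ℂ) ^ (3 * n))⁻¹ • (f (ip ((2 : ℂ) ^ n • x) ((2 : ℂ) ^ n • y) • (2 : ℂ) ^ n • z) -
            ip (f ((2 : ℂ) ^ n • x)) ((2 : ℂ) ^ n • y) • (2 : ℂ) ^ n • z -
            ip ((2 : ℂ) ^ n • x) (f ((2 : ℂ) ^ n • y)) • (2 : ℂ) ^ n • z -
            ip ((2 : ℂ) ^ n • x) ((2 : ℂ) ^ n • y) • f ((2 : ℂ) ^ n • z)) := by
        simp only [hip, CStarModule.inner_smul_left_complex, star_inv₀, hs,
          CStarModule.inner_smul_right_complex, smul_comm (_ : A) (_ : ℂ), smul_assoc, hp,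
          smul_sub, smul_smul]
        congr! 2 <;> field_simp
      refine (congrArg norm key).trans_le ?_
      rw [norm_smul, norm_inv, norm_pow, Complex.norm_ofNat, inv_mul_eq_div]
      have h8 : (2 : ℝ) ^ n ≤ 2 ^ (3 * n) := pow_le_pow_right₀ one_le_two (by lia)
      have hφ := φ_nonneg 0 0 ((2 : ℂ) ^ n • x) ((2 : ℂ) ^ n • y) ((2 : ℂ) ^ n • z)
      gcongr
    rwa [sub_sub, sub_sub, sub_eq_zero, ← add_assoc] at h3
  · exact tendsto_nhds_unique (tendsto_inv_two_pow_smul_of_norm_sub_le hL₀ hL₀1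
      (div_nonneg hL₀ (sub_nonneg.2 hL₀1.le)) hψ2 hS.1.map_smul hSf x) (hT x)
end

section
/- Let V and W be complex vector spaces and let T : V → W be an additive mapping (T(x + y) = T(x) + T(y) for all x, y ∈ V) such that T(μx) = μT(x) for every μ ∈ 𝕋 = {z ∈ ℂ : |z| = 1} and every x ∈ V. Then T is ℂ-linear, i.e. T(λx) = λT(x) for every λ ∈ ℂ and every x ∈ V. -/
/-- Every complex number is an integer combination of points of the unit circle. -/
theorem Complex.addSubgroup_closure_norm_eq_one :
    AddSubgroup.closure {μ : ℂ | ‖μ‖ = 1} = ⊤ := by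
  refine (AddSubgroup.eq_top_iff' _).2 fun z => ?_
  obtain ⟨n, hn⟩ := exists_nat_gt ‖z‖
  have hn0 : (0 : ℝ) < n := (norm_nonneg z).trans_lt hn
  set t : ℝ := ‖z‖ / (2 * n) with ht
  have ht0 : 0 ≤ t := by positivity
  have ht1 : t ≤ 1 := by
    rw [ht, div_le_one (by positivity)]
    linarith
  set θ : ℝ := Real.arccos t
  have hcos : Complex.cos θ = t := by
    rw [← Complex.ofReal_cos, Real.cos_arccos (by linarith) ht1]
  have hsum : Complex.exp ((z.arg + θ : ℝ) * Complex.I) +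
      Complex.exp ((z.arg - θ : ℝ) * Complex.I) =
      2 * t * Complex.exp (z.arg * Complex.I) := by
    rw [← hcos, Complex.two_cos, add_mul, ← Complex.exp_add, ← Complex.exp_add]
    push_cast
    ring_nf
  have hz : z = n • (Complex.exp ((z.arg + θ : ℝ) * Complex.I) +
      Complex.exp ((z.arg - θ : ℝ) * Complex.I)) := by
    have hnt : (n : ℂ) * (2 * t) = ‖z‖ := by
      rw [ht]
      norm_cast
      push_cast
      field_simp
    rw [hsum, nsmul_eq_mul, ← mul_assoc, hnt, Complex.norm_mul_exp_arg_mul_I]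
  have hexp (s : ℝ) :
      Complex.exp (s * Complex.I) ∈ AddSubgroup.closure {μ : ℂ | ‖μ‖ = 1} :=
    AddSubgroup.subset_closure (Complex.norm_exp_ofReal_mul_I s)
  rw [hz]
  exact nsmul_mem (add_mem (hexp _) (hexp _)) n

/-- Let `V` and `W` be complex vector spaces and `T : V → W` an additive mapping such
that `T (μ • x) = μ • T x` for every `μ` in the unit circle `𝕋 = {z : ℂ | ‖z‖ = 1}` and
every `x ∈ V`.  Then `T` is ℂ-linear. -/
theorem additive_circle_homogeneous_is_linear
    {V W : Type*} [AddCommGroup V] [Module ℂ V] [AddCommGroup W] [Module ℂ W]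
    (T : V → W)
    (hadd : ∀ x y : V, T (x + y) = T x + T y)
    (hcirc : ∀ μ : ℂ, ‖μ‖ = 1 → ∀ x : V, T (μ • x) = μ • T x) :
    IsLinearMap ℂ T := by
  refine ⟨hadd, fun c x => ?_⟩
  let f : V →+ W := AddMonoidHom.mk' T hadd
  have hc : c ∈ AddSubgroup.closure {μ : ℂ | ‖μ‖ = 1} := by
    rw [Complex.addSubgroup_closure_norm_eq_one]
    exact AddSubgroup.mem_top c
  change f (c • x) = c • f x
  induction hc using AddSubgroup.closure_induction with
  | mem μ hμ => exact hcirc μ hμ x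
  | zero => simp
  | add a b _ _ ha hb => rw [add_smul, add_smul, map_add, ha, hb]
  | neg a _ ha => rw [neg_smul, neg_smul, map_neg, ha]
end
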